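/- For every integer n ≥ 1, Σ_{σ ∈ CQ_{n+1}} x^{cap(σ)} = 2^n · x · A_n(x) as polynomials in x, where CQ_{n+1} is the set of Stirling permutations of the second kind of order n+1 consisting of a single cycle. -/

import Mathlib

open scoped Classical
noncomputable section

/-- The multiset `{1,1,2,2,…,n,n}` as a list. -/
def baseList (n : ℕ) : List ℕ := (List.range n).flatMap (fun i => [i + 1, i + 1])

/-- A word is Stirling if whenever the same value occurs at positions `i < k`,
every entry strictly between them is greater than that value. -/
def IsStirlingWord (l : List ℕ) : Prop :=
  ∀ i j k : Fin l.length, i < j → j < k → l.get i = l.get k → l.get i < l.get j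

/-- The set `Q_n` of Stirling permutations of order `n`:  rearrangements of the
multiset `{1,1,2,2,…,n,n}` in which all entries between the two occurrences of any
value exceed that value. -/
def stirlingPerms (n : ℕ) : Finset (List ℕ) :=
  ((baseList n).permutations.toFinset).filter IsStirlingWord

/-- Number of descents of `σ ∈ Q_n`: indices `i ∈ {1,…,2n}` (here 0-based) with
`σ_i > σ_{i+1}`, with the convention `σ_{2n+1} = 0`. -/
def desList (l : List ℕ) : ℕ :=
  ((Finset.range l.length).filter (fun i => l.getD (i + 1) 0 < l.getD i 0)).card

/-- The second-order Eulerian polynomial `C_n(x) = ∑_{σ ∈ Q_n} x^{des σ}`. -/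
def Cpoly (n : ℕ) : Polynomial ℚ :=
  ∑ σ ∈ stirlingPerms n, Polynomial.X ^ desList σ

/-- A list of cycles is a valid standard cycle form of a Stirling permutation of the
second kind of order `n` if:  the cycles are disjoint and together use each of
`1,1,2,2,…,n,n` exactly once; both copies of any value lie in the same cycle; each
cycle starts with (one of) its smallest entries; the cycles are listed in increasing
order of their smallest (first) entries; and the word of each cycle reduces to a
Stirling permutation. -/
def IsStirling2 (n : ℕ) (c : List (List ℕ)) : Prop :=
  c.flatten.Perm (baseList n) ∧
  (∀ w ∈ c, w ≠ [] ∧ (∀ v ∈ w, w.count v = 2) ∧ (∀ v ∈ w, w.headI ≤ v) ∧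
      IsStirlingWord w) ∧
  c.Chain' (fun w₁ w₂ => w₁.headI < w₂.headI)

/-- The set `Q_n²` of Stirling permutations of the second kind of order `n`,
each recorded as its standard cycle form (a list of cycles). -/
def stirling2 (n : ℕ) : Finset (List (List ℕ)) :=
  ((((baseList n).permutations.toFinset) ×ˢ (Finset.univ : Finset (Composition (2 * n)))).image
      (fun p => p.1.splitWrtComposition p.2)).filter (IsStirling2 n)

/-- `cyc(σ)`: the number of cycles. -/
def cyc (c : List (List ℕ)) : ℕ := c.length

/-- `cplat(σ)`: the number of cycle plateaus, i.e. entries `c_i` of a cycle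
`(c_1,…,c_{2k})` with `c_i = c_{i+1}`, `1 ≤ i < 2k`. -/
def cplat (c : List (List ℕ)) : ℕ :=
  (c.map (fun w => ((Finset.range w.length).filter
    (fun i => i + 1 < w.length ∧ w.getD i 0 = w.getD (i + 1) 0)).card)).sum

/-- `casc(σ)`: the number of cycle ascents, i.e. entries `c_i` of a cycle
`(c_1,…,c_{2k})` with `c_i < c_{i+1}`, `1 ≤ i < 2k`. -/
def casc (c : List (List ℕ)) : ℕ :=
  (c.map (fun w => ((Finset.range w.length).filter
    (fun i => i + 1 < w.length ∧ w.getD i 0 < w.getD (i + 1) 0)).card)).sum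

/-- `cap(σ)`: the number of cycle ascent plateaus, i.e. entries `c_i` of a cycle
`(c_1,…,c_{2k})` with `c_{i-1} < c_i = c_{i+1}`, `2 ≤ i ≤ 2k-1`. -/
def capSt (c : List (List ℕ)) : ℕ :=
  (c.map (fun w => ((Finset.range w.length).filter
    (fun i => 0 < i ∧ i + 1 < w.length ∧
      w.getD (i - 1) 0 < w.getD i 0 ∧ w.getD i 0 = w.getD (i + 1) 0)).card)).sum

/-- `fix(σ)`: the number of fixed points, i.e. values `k` with `(k,k)` a cycle of `σ`. -/
def fixSt (c : List (List ℕ)) : ℕ :=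
  ((Finset.range c.length).filter (fun i => ∃ k : ℕ, c.getD i [] = [k, k])).card

/-- Number of descents of a permutation of `Fin n`:
indices `i ∈ {1,…,n-1}` (0-based `i` with `i+1 < n`) such that `π i > π (i+1)`. -/
def desA (n : ℕ) (π : Equiv.Perm (Fin n)) : ℕ :=
  (Finset.univ.filter (fun i : Fin n => ∃ h : i.1 + 1 < n, π ⟨i.1 + 1, h⟩ < π i)).card

/-- The Eulerian polynomial `A_n(x) = ∑_{π ∈ S_n} x^{des π}`. -/
def eulerianA (n : ℕ) : Polynomial ℚ :=
  ∑ π : Equiv.Perm (Fin n), Polynomial.X ^ desA n π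

open Polynomial in
/-- The operator `p ↦ X (1 - X) p' + m X p`, which sends `X ^ a` to
`a X ^ a + (m - a) X ^ (a + 1)`. -/
def eulerOp (m : ℕ) (p : Polynomial ℚ) : Polynomial ℚ :=
  X * (1 - X) * derivative p + (m : Polynomial ℚ) * X * p

open Polynomial in
theorem eulerOp_sum_X_pow {ι : Type*} (m : ℕ) (s : Finset ι) (f : ι → ℕ) :
    eulerOp m (∑ i ∈ s, X ^ f i) =
      ∑ i ∈ s, ((f i : Polynomial ℚ) * X ^ f i + ((m : Polynomial ℚ) - (f i : Polynomial ℚ)) * X ^ (f i + 1)) := by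
  unfold eulerOp
  rw [derivative_sum, Finset.mul_sum, Finset.mul_sum, ← Finset.sum_add_distrib]
  refine Finset.sum_congr rfl fun i _ => ?_
  rw [derivative_X_pow]
  rcases f i with _ | a
  · simp
  · simp only [map_natCast, Nat.add_sub_cancel]
    push_cast
    ring

/-- The list `l` with `k` copies of `M` inserted at position `p`. -/
def insertCopies (k M : ℕ) (l : List ℕ) (p : ℕ) : List ℕ :=
  l.take p ++ (List.replicate k M ++ l.drop p)

theorem insertCopies_perm (k M : ℕ) (l : List ℕ) (p : ℕ) :
    (insertCopies k M l p).Perm (l ++ List.replicate k M) := by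
  unfold insertCopies
  refine (List.Perm.append_left _ List.perm_append_comm).trans ?_
  rw [← List.append_assoc, List.take_append_drop]

theorem filter_insertCopies {k M : ℕ} {l : List ℕ} (hM : M ∉ l) (p : ℕ) :
    (insertCopies k M l p).filter (· ≠ M) = l := by
  unfold insertCopies
  have h : l.filter (· ≠ M) = l := by
    rw [List.filter_eq_self]
    intro a ha
    simpa using fun h : a = M => hM (h ▸ ha)
  have h2 : (List.replicate k M).filter (· ≠ M) = [] := by
    rw [List.filter_eq_nil_iff]
    intro a ha
    simp [List.eq_of_mem_replicate ha]
  rw [List.filter_append, List.filter_append, h2, List.nil_append, ← List.filter_append,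
    List.take_append_drop, h]

theorem idxOf_insertCopies {k M : ℕ} {l : List ℕ} (hk : 0 < k) (hM : M ∉ l) {p : ℕ}
    (hp : p ≤ l.length) : (insertCopies k M l p).idxOf M = p := by
  obtain ⟨k, rfl⟩ := Nat.exists_eq_succ_of_ne_zero hk.ne'
  unfold insertCopies
  rw [List.idxOf_append_of_notMem (fun h => hM (List.mem_of_mem_take h)), List.replicate_succ,
    List.cons_append, List.idxOf_cons_self, List.length_take]
  omega

theorem insertCopies_inj {k M : ℕ} {l l' : List ℕ} (hk : 0 < k) (hM : M ∉ l) (hM' : M ∉ l')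
    {p p' : ℕ} (hp : p ≤ l.length) (hp' : p' ≤ l'.length)
    (h : insertCopies k M l p = insertCopies k M l' p') : l = l' ∧ p = p' := by
  constructor
  · rw [← filter_insertCopies (k := k) hM p, h, filter_insertCopies hM']
  · rw [← idxOf_insertCopies hk hM hp, h, idxOf_insertCopies hk hM' hp']

/-- The number of descents of a list. -/
def listDes : List ℕ → ℕ
  | a :: b :: t => (if b < a then 1 else 0) + listDes (b :: t)
  | _ => 0

/-- The number of ascent plateaus of a list. -/
def listCap : List ℕ → ℕ
  | a :: b :: c :: t => (if a < b ∧ b = c then 1 else 0) + listCap (b :: c :: t)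
  | _ => 0

theorem listDes_cons_of_lt {M : ℕ} {l : List ℕ} (h : ∀ v ∈ l, v < M) (hl : l ≠ []) :
    listDes (M :: l) = 1 + listDes l := by
  cases l with
  | nil => exact absurd rfl hl
  | cons a t => simp [listDes, h a (by simp)]

theorem listCap_cons_of_lt {M : ℕ} {l : List ℕ} (h : ∀ v ∈ l, v < M) :
    listCap (M :: l) = listCap l := by
  rcases l with _ | ⟨a, _ | ⟨b, t⟩⟩
  · simp [listCap]
  · simp [listCap]
  · have := h a (by simp)
    simp [listCap, this.not_gt]

theorem listCap_cons_cons_self {M : ℕ} {l : List ℕ} (h : ∀ v ∈ l, v < M) :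
    listCap (M :: M :: l) = listCap l := by
  rcases l with _ | ⟨a, t⟩
  · simp [listCap]
  · rw [← listCap_cons_of_lt h]
    simp [listCap]

theorem listCap_insert_after_head {a M : ℕ} {l : List ℕ} (ha : a < M) (h : ∀ v ∈ l, v < M) :
    listCap (a :: M :: M :: l) = 1 + listCap l := by
  rw [← listCap_cons_cons_self h]
  simp [listCap, ha]

open Polynomial in
theorem sum_listDes_insertCopies {M : ℕ} (l : List ℕ) (h : ∀ v ∈ l, v < M) :
    ∑ p ∈ Finset.range (l.length + 1), (X : Polynomial ℚ) ^ listDes (insertCopies 1 M l p) =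
      (listDes l + 1 : Polynomial ℚ) * X ^ listDes l +
        ((l.length : Polynomial ℚ) - (listDes l : Polynomial ℚ)) * X ^ (listDes l + 1) := by
  induction l with
  | nil => simp [insertCopies, listDes]
  | cons a t ih =>
    have ht : ∀ v ∈ t, v < M := fun v hv => h v (by simp [hv])
    have ha : a < M := h a (by simp)
    rcases t with _ | ⟨b, s⟩
    · simp [insertCopies, listDes, Finset.sum_range_succ, ha, ha.not_gt, add_comm]
    · have ih := ih ht
      rw [Finset.sum_range_succ'] at ih
      rw [List.length_cons, Finset.sum_range_succ', Finset.sum_range_succ']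
      have h0 : listDes (insertCopies 1 M (a :: b :: s) 0) = 1 + listDes (a :: b :: s) :=
        listDes_cons_of_lt h (by simp)
      have h0' : listDes (insertCopies 1 M (b :: s) 0) = 1 + listDes (b :: s) :=
        listDes_cons_of_lt ht (by simp)
      have h1 : listDes (insertCopies 1 M (a :: b :: s) (0 + 1)) = 1 + listDes (b :: s) := by
        rw [← listDes_cons_of_lt ht (by simp)]
        simp [insertCopies, listDes, ha.not_gt]
      have h2 : ∀ p, listDes (insertCopies 1 M (a :: b :: s) (p + 1 + 1)) =
          (if b < a then 1 else 0) + listDes (insertCopies 1 M (b :: s) (p + 1)) := by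
        intro p
        simp [insertCopies, listDes]
      have hd : listDes (a :: b :: s) = (if b < a then 1 else 0) + listDes (b :: s) := rfl
      rw [h0'] at ih
      rw [h0, h1, hd]
      simp only [h2, pow_add _ (if b < a then 1 else 0), ← Finset.mul_sum]
      rw [← eq_sub_iff_add_eq] at ih
      rw [ih]
      simp only [List.length_cons]
      split_ifs <;> push_cast <;> ring

open Polynomial in
theorem sum_listCap_insertCopies {M : ℕ} (l : List ℕ) (h : ∀ v ∈ l, v < M) :
    ∑ p ∈ Finset.range l.length, (X : Polynomial ℚ) ^ listCap (insertCopies 2 M l (p + 1)) =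
      2 * ((listCap l : Polynomial ℚ) * X ^ listCap l) +
        ((l.length : Polynomial ℚ) - 2 * (listCap l : Polynomial ℚ)) * X ^ (listCap l + 1) := by
  induction l with
  | nil => simp [listCap]
  | cons a t ih =>
    have ht : ∀ v ∈ t, v < M := fun v hv => h v (by simp [hv])
    have ha : a < M := h a (by simp)
    rcases t with _ | ⟨b, _ | ⟨c, s⟩⟩
    · simp [insertCopies, listCap, ha]
    · have hb : b < M := ht b (by simp)
      simp [insertCopies, listCap, Finset.sum_range_succ, ha, hb, hb.ne]
      ring
    · have ih := ih ht
      have hs : ∀ v ∈ c :: s, v < M := fun v hv => ht v (List.mem_cons_of_mem _ hv)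
      have hb : b < M := ht b (by simp)
      rw [List.length_cons, Finset.sum_range_succ'] at ih ⊢
      rw [List.length_cons, Finset.sum_range_succ']
      have h1 : listCap (insertCopies 2 M (a :: b :: c :: s) (0 + 1)) =
          1 + listCap (b :: c :: s) := listCap_insert_after_head ha ht
      have h1' : listCap (insertCopies 2 M (b :: c :: s) (0 + 1)) =
          1 + listCap (c :: s) := listCap_insert_after_head hb hs
      have h2 : listCap (insertCopies 2 M (a :: b :: c :: s) (0 + 1 + 1)) =
          1 + listCap (c :: s) := by
        rw [← listCap_insert_after_head hb hs]
        simp [insertCopies, listCap, hb.ne]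
      have h3 : ∀ p, listCap (insertCopies 2 M (a :: b :: c :: s) (p + 1 + 1 + 1)) =
          (if a < b ∧ b = c then 1 else 0) +
            listCap (insertCopies 2 M (b :: c :: s) (p + 1 + 1)) := by
        intro p
        simp [insertCopies, listCap]
      have hd : listCap (a :: b :: c :: s) =
          (if a < b ∧ b = c then 1 else 0) + listCap (b :: c :: s) := rfl
      have hbc : b = c → listCap (c :: s) = listCap (b :: c :: s) := by
        rintro rfl
        cases s <;> simp [listCap]
      rw [h1'] at ih
      rw [h1, h2, hd]
      simp only [h3, pow_add _ (if a < b ∧ b = c then 1 else 0), ← Finset.mul_sum]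
      rw [← eq_sub_iff_add_eq] at ih
      rw [ih]
      simp only [List.length_cons]
      split_ifs with he
      · rw [hbc he.2]
        push_cast
        ring
      · push_cast
        ring

theorem card_filter_descents (l : List ℕ) :
    ((Finset.range l.length).filter
      (fun i => i + 1 < l.length ∧ l.getD (i + 1) 0 < l.getD i 0)).card = listDes l := by
  rw [Finset.card_filter]
  induction l with
  | nil => rfl
  | cons a t ih =>
    rcases t with _ | ⟨b, s⟩
    · simp [listDes]
    · rw [List.length_cons, Finset.sum_range_succ', listDes, ← ih, add_comm]
      simp

theorem card_filter_ascentPlateaus (l : List ℕ) :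
    ((Finset.range l.length).filter
      (fun i => 0 < i ∧ i + 1 < l.length ∧
        l.getD (i - 1) 0 < l.getD i 0 ∧ l.getD i 0 = l.getD (i + 1) 0)).card = listCap l := by
  rw [Finset.card_filter]
  induction l with
  | nil => rfl
  | cons a t ih =>
    rcases t with _ | ⟨b, _ | ⟨c, s⟩⟩
    · simp [listCap]
    · simp [listCap, Finset.sum_range_succ, -Finset.sum_boole]
    · rw [List.length_cons, Finset.sum_range_succ'] at ih
      rw [List.length_cons, List.length_cons, Finset.sum_range_succ', Finset.sum_range_succ',
        listCap, ← ih, add_comm (ite _ _ _)]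
      simp

/-- The rearrangements of `0, …, n - 1`. -/
def permWords (n : ℕ) : Finset (List ℕ) := (List.range n).permutations.toFinset

theorem mem_permWords {n : ℕ} {l : List ℕ} : l ∈ permWords n ↔ l.Perm (List.range n) := by
  simp [permWords]

theorem desA_eq_listDes (n : ℕ) (π : Equiv.Perm (Fin n)) :
    desA n π = listDes (List.ofFn fun i => (π i : ℕ)) := by
  rw [← card_filter_descents, desA, Finset.card_filter, Finset.card_filter, List.length_ofFn,
    ← Fin.sum_univ_eq_sum_range (fun i => if i + 1 < n ∧
      (List.ofFn fun i => (π i : ℕ)).getD (i + 1) 0 < (List.ofFn fun i => (π i : ℕ)).getD i 0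
      then 1 else 0)]
  refine Finset.sum_congr rfl fun i _ => ?_
  congr 1
  rw [← exists_prop]
  simp only [eq_iff_iff]
  refine exists_congr fun h => ?_
  simp [List.getD_eq_getElem?_getD, h]

theorem eulerianA_eq_sum_permWords (n : ℕ) :
    eulerianA n = ∑ l ∈ permWords n, Polynomial.X ^ listDes l := by
  unfold eulerianA
  refine Finset.sum_bij (fun π _ => List.ofFn fun i => (π i : ℕ)) ?_ ?_ ?_ ?_
  · intro π _
    rw [mem_permWords, List.perm_ext_iff_of_nodup _ List.nodup_range]
    · intro a
      simp only [List.mem_ofFn, List.mem_range]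
      constructor
      · rintro ⟨i, rfl⟩
        exact (π i).2
      · intro ha
        exact ⟨π.symm ⟨a, ha⟩, by simp⟩
    · rw [List.nodup_ofFn]
      exact Fin.val_injective.comp π.injective
  · intro π _ π' _ h
    ext i
    exact congrFun (List.ofFn_injective h) i
  · intro l hl
    rw [mem_permWords] at hl
    have hlen : l.length = n := by simpa using hl.length_eq
    have hnd : l.Nodup := hl.nodup_iff.2 List.nodup_range
    subst hlen
    let f : Fin l.length → Fin l.length :=
      fun i => ⟨l.get i, List.mem_range.1 (hl.subset (l.get_mem i))⟩
    have hf : Function.Injective f := by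
      intro i j hij
      exact List.nodup_iff_injective_get.1 hnd (by simpa [f] using hij)
    refine ⟨Equiv.ofBijective f (Finite.injective_iff_bijective.1 hf), Finset.mem_univ _, ?_⟩
    simp [f]
  · intro π _
    rw [desA_eq_listDes]

theorem sum_permWords_succ {R : Type*} [AddCommMonoid R] (n : ℕ) (f : List ℕ → R) :
    ∑ l ∈ permWords (n + 1), f l =
      ∑ l ∈ permWords n, ∑ p ∈ Finset.range (l.length + 1), f (insertCopies 1 n l p) := by
  have hnot : ∀ l ∈ permWords n, n ∉ l := fun l hl h => by
    simpa using (mem_permWords.1 hl).subset h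
  rw [Finset.sum_sigma' (permWords n) (fun l => Finset.range (l.length + 1))
    (fun l p => f (insertCopies 1 n l p))]
  symm
  refine Finset.sum_bij (fun x _ => insertCopies 1 n x.1 x.2) ?_ ?_ ?_ ?_
  · rintro ⟨l, p⟩ hx
    rw [Finset.mem_sigma] at hx
    rw [mem_permWords, List.range_succ]
    exact (insertCopies_perm _ _ _ _).trans ((mem_permWords.1 hx.1).append_right _)
  · rintro ⟨l, p⟩ hx ⟨l', p'⟩ hx' h
    rw [Finset.mem_sigma, Finset.mem_range] at hx hx'
    obtain ⟨rfl, rfl⟩ := insertCopies_inj one_pos (hnot _ hx.1) (hnot _ hx'.1)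
      (Nat.lt_succ_iff.1 hx.2) (Nat.lt_succ_iff.1 hx'.2) h
    rfl
  · intro w hw
    rw [mem_permWords] at hw
    obtain ⟨a, b, rfl⟩ := List.append_of_mem (hw.symm.subset (by simp : n ∈ List.range (n + 1)))
    refine ⟨⟨a ++ b, a.length⟩, ?_, by simp [insertCopies]⟩
    rw [Finset.mem_sigma, mem_permWords]
    constructor
    · rw [← List.perm_cons n]
      refine List.perm_middle.symm.trans (hw.trans ?_)
      rw [List.range_succ]
      exact List.perm_append_singleton _ _
    · simp
  · intro _ _
    rfl

theorem X_mul_eulerianA_succ (n : ℕ) :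
    Polynomial.X * eulerianA (n + 1) = eulerOp (n + 1) (Polynomial.X * eulerianA n) := by
  have h : Polynomial.X * eulerianA n = ∑ l ∈ permWords n, Polynomial.X ^ (listDes l + 1) := by
    rw [eulerianA_eq_sum_permWords, Finset.mul_sum]
    exact Finset.sum_congr rfl fun l _ => by ring
  rw [h, eulerOp_sum_X_pow, eulerianA_eq_sum_permWords, sum_permWords_succ, Finset.mul_sum]
  refine Finset.sum_congr rfl fun l hl => ?_
  have hl := mem_permWords.1 hl
  rw [sum_listDes_insertCopies l fun v hv => List.mem_range.1 (hl.subset hv), hl.length_eq,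
    List.length_range]
  push_cast
  ring

theorem eulerianA_one : eulerianA 1 = 1 := by
  simp [eulerianA, desA_eq_listDes, listDes]

theorem isStirlingWord_iff_sublist {l : List ℕ} :
    IsStirlingWord l ↔ ∀ a b, [a, b, a].Sublist l → a < b := by
  constructor
  · intro h a b hs
    obtain ⟨f, hf⟩ := List.sublist_iff_exists_fin_orderEmbedding_get_eq.1 hs
    have h0 := hf ⟨0, by simp⟩
    have h1 := hf ⟨1, by simp⟩
    have h2 := hf ⟨2, by simp⟩
    have := h (f ⟨0, by simp⟩) (f ⟨1, by simp⟩) (f ⟨2, by simp⟩)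
      (f.lt_iff_lt.2 (by simp)) (f.lt_iff_lt.2 (by simp)) (by rw [← h0, ← h2]; rfl)
    rwa [← h0, ← h1] at this
  · intro h i j k hij hjk hik
    refine h _ _ ?_
    have : [l.get i, l.get j, l.get i] = [i, j, k].map l.get := by rw [List.map_cons, List.map_cons, List.map_singleton, ← hik]
    rw [this]
    refine List.map_getElem_sublist ?_
    simp [hij, hjk, hij.trans hjk]

theorem baseList_succ (n : ℕ) : baseList (n + 1) = baseList n ++ List.replicate 2 (n + 1) := by
  simp [baseList, List.range_succ]

theorem mem_baseList {n v : ℕ} : v ∈ baseList n ↔ 1 ≤ v ∧ v ≤ n := by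
  simp only [baseList, List.mem_flatMap, List.mem_range, List.mem_cons, List.not_mem_nil, or_false,
    or_self]
  constructor
  · rintro ⟨a, ha, rfl⟩
    omega
  · intro h
    exact ⟨v - 1, by omega, by omega⟩

theorem length_baseList (n : ℕ) : (baseList n).length = 2 * n := by
  induction n with
  | zero => rfl
  | succ n ih => rw [baseList_succ, List.length_append, ih, List.length_replicate]; ring

theorem count_baseList {n v : ℕ} (hv : v ∈ baseList n) : (baseList n).count v = 2 := by
  induction n with
  | zero => simp [baseList] at hv
  | succ n ih =>
    rw [baseList_succ, List.count_append, List.count_replicate]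
    by_cases h : v = n + 1
    · subst h
      rw [List.count_eq_zero_of_not_mem (by rw [mem_baseList]; omega)]
      simp
    · rw [ih (by rw [mem_baseList] at hv ⊢; omega)]
      simp [Ne.symm h]

/-- The words of the cyclic Stirling permutations of order `n`. -/
def cyclicWords (n : ℕ) : Finset (List ℕ) :=
  (stirlingPerms n).filter fun w => w.headI = 1

theorem mem_cyclicWords {n : ℕ} {w : List ℕ} :
    w ∈ cyclicWords n ↔ w.Perm (baseList n) ∧ IsStirlingWord w ∧ w.headI = 1 := by
  simp [cyclicWords, stirlingPerms, and_assoc]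

theorem isStirling2_singleton {n : ℕ} (hn : 1 ≤ n) {w : List ℕ} :
    IsStirling2 n [w] ↔ w ∈ cyclicWords n := by
  rw [mem_cyclicWords]
  unfold IsStirling2
  simp only [List.flatten_cons, List.flatten_nil, List.append_nil, List.mem_singleton,
    forall_eq]
  refine and_congr_right fun hp => ?_
  have h1 : 1 ∈ w := hp.symm.subset (mem_baseList.2 ⟨le_rfl, hn⟩)
  have hne : w ≠ [] := List.ne_nil_of_mem h1
  have hhead : w.headI ∈ w := by
    cases w with
    | nil => exact absurd rfl hne
    | cons a t => simp
  constructor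
  · rintro ⟨⟨_, _, hmin, hs⟩, _⟩
    exact ⟨hs, le_antisymm (hmin 1 h1) (mem_baseList.1 (hp.subset hhead)).1⟩
  · rintro ⟨hs, hh⟩
    refine ⟨⟨hne, fun v hv => ?_, fun v hv => ?_, hs⟩, List.isChain_singleton _⟩
    · rw [hp.count_eq, count_baseList (hp.subset hv)]
    · rw [hh]
      exact (mem_baseList.1 (hp.subset hv)).1

theorem singleton_mem_stirling2 {n : ℕ} (hn : 1 ≤ n) {w : List ℕ} :
    [w] ∈ stirling2 n ↔ w ∈ cyclicWords n := by
  unfold stirling2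
  rw [Finset.mem_filter, isStirling2_singleton hn, and_iff_right_iff_imp]
  intro hw
  have hp := (mem_cyclicWords.1 hw).1
  have hlen : w.length = 2 * n := by rw [hp.length_eq, length_baseList]
  rw [Finset.mem_image]
  refine ⟨(w, Composition.single (2 * n) (by omega)), by simpa using hp, ?_⟩
  simp only
  have hfl := List.flatten_splitWrtComposition w
  have hl := List.length_splitWrtComposition w (Composition.single (2 * n) (by omega))
  rw [Composition.single_length, List.length_eq_one_iff] at hl
  obtain ⟨u, hu⟩ := hl
  have := List.flatten_splitWrtCompositionAux (l := w)
    (ns := (Composition.single (2 * n) (by omega)).blocks)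
    (by rw [hlen]; exact (Composition.single (2 * n) (by omega)).blocks_sum)
  rw [← List.splitWrtComposition, hu] at this
  rw [hu]
  simpa using this

theorem sum_cyclic_eq_sum_cyclicWords {n : ℕ} (hn : 1 ≤ n) :
    ∑ σ ∈ (stirling2 n).filter (fun c => cyc c = 1), (Polynomial.X : Polynomial ℚ) ^ capSt σ =
      ∑ w ∈ cyclicWords n, Polynomial.X ^ listCap w := by
  symm
  refine Finset.sum_bij (fun w _ => [w]) ?_ ?_ ?_ ?_
  · intro w hw
    rw [Finset.mem_filter, singleton_mem_stirling2 hn]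
    exact ⟨hw, rfl⟩
  · intro w _ w' _ h
    simpa using h
  · intro c hc
    rw [Finset.mem_filter] at hc
    obtain ⟨w, rfl⟩ := List.length_eq_one_iff.1 hc.2
    exact ⟨w, (singleton_mem_stirling2 hn).1 hc.1, rfl⟩
  · intro w _
    rw [capSt, List.map_singleton, List.sum_singleton, card_filter_ascentPlateaus]

theorem isStirlingWord_insertCopies {M : ℕ} {w : List ℕ} (h : IsStirlingWord w)
    (hM : ∀ v ∈ w, v < M) (p : ℕ) : IsStirlingWord (insertCopies 2 M w p) := by
  rw [isStirlingWord_iff_sublist] at h ⊢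
  have hnot : M ∉ w := fun h => (hM M h).false
  intro x y hs
  have hmem : ∀ v ∈ insertCopies 2 M w p, v ≤ M := by
    intro v hv
    have := (insertCopies_perm 2 M w p).subset hv
    rw [List.mem_append] at this
    rcases this with hv | hv
    · exact (hM v hv).le
    · exact (List.eq_of_mem_replicate hv).le
  by_cases hx : x = M
  · subst hx
    exfalso
    unfold insertCopies at hs
    rw [List.sublist_append_iff] at hs
    obtain ⟨l₁, l₂, hl, h1, h2⟩ := hs
    rcases l₁ with _ | ⟨z, l₁⟩
    · rw [List.nil_append] at hl
      subst hl
      have hd : x ∉ w.drop p := fun h => hnot (List.mem_of_mem_drop h)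
      have h3 : [y, x].Sublist (x :: w.drop p) := List.cons_sublist_cons.1 h2
      rcases List.sublist_cons_iff.1 h3 with h4 | ⟨r, hr, h4⟩
      · exact hd (h4.subset (by simp))
      · obtain rfl : [x] = r := by simpa using (List.cons_eq_cons.1 hr).2
        exact hd (h4.subset (by simp))
    · obtain rfl : x = z := by simpa using (List.cons_eq_cons.1 hl).1
      exact hnot (List.mem_of_mem_take (h1.subset (by simp)))
  · by_cases hy : y = M
    · subst hy
      exact lt_of_le_of_ne (hmem x (hs.subset (by simp))) hx
    · have := hs.filter (· ≠ M)
      rw [filter_insertCopies hnot] at this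
      exact h x y (by simpa [hx, hy] using this)

theorem IsStirlingWord.exists_eq_append {M : ℕ} {w : List ℕ} (h : IsStirlingWord w)
    (hM : ∀ v ∈ w, v ≤ M) (hc : w.count M = 2) : ∃ a b, w = a ++ M :: M :: b := by
  rw [isStirlingWord_iff_sublist] at h
  have hmem : M ∈ w := List.count_pos_iff.1 (by omega)
  obtain ⟨a, r, rfl, ha⟩ := List.eq_append_cons_of_mem hmem
  have hr : M ∈ r := by
    rw [List.count_append, List.count_eq_zero_of_not_mem ha, List.count_cons_self] at hc
    exact List.count_pos_iff.1 (by omega)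
  obtain ⟨c, b, rfl⟩ := List.append_of_mem hr
  rcases c with _ | ⟨z, c⟩
  · exact ⟨a, b, rfl⟩
  · exfalso
    refine (h M z ?_).not_ge (hM z (by simp))
    refine List.Sublist.trans ?_ (List.sublist_append_right a _)
    refine List.Sublist.cons_cons _ (List.Sublist.cons_cons _ ?_)
    exact List.singleton_sublist.2 (by simp)

theorem sum_cyclicWords_succ {R : Type*} [AddCommMonoid R] {n : ℕ} (hn : 1 ≤ n)
    (f : List ℕ → R) :
    ∑ w ∈ cyclicWords (n + 1), f w =
      ∑ w ∈ cyclicWords n, ∑ p ∈ Finset.range w.length, f (insertCopies 2 (n + 1) w (p + 1)) := by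
  have hlt : ∀ w ∈ cyclicWords n, ∀ v ∈ w, v < n + 1 := fun w hw v hv =>
    Nat.lt_succ_iff.2 (mem_baseList.1 ((mem_cyclicWords.1 hw).1.subset hv)).2
  have hnot : ∀ w ∈ cyclicWords n, n + 1 ∉ w := fun w hw h => (hlt w hw _ h).false
  rw [Finset.sum_sigma' (cyclicWords n) (fun w => Finset.range w.length)
    (fun w p => f (insertCopies 2 (n + 1) w (p + 1)))]
  symm
  refine Finset.sum_bij (fun x _ => insertCopies 2 (n + 1) x.1 (x.2 + 1)) ?_ ?_ ?_ ?_
  · rintro ⟨w, p⟩ hx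
    rw [Finset.mem_sigma, Finset.mem_range] at hx
    obtain ⟨hp, hs, hh⟩ := mem_cyclicWords.1 hx.1
    rw [mem_cyclicWords, baseList_succ]
    refine ⟨(insertCopies_perm _ _ _ _).trans (hp.append_right _),
      isStirlingWord_insertCopies hs (hlt w hx.1) _, ?_⟩
    cases w with
    | nil => simp at hx
    | cons a t => simpa [insertCopies] using hh
  · rintro ⟨w, p⟩ hx ⟨w', p'⟩ hx' h
    rw [Finset.mem_sigma, Finset.mem_range] at hx hx'
    obtain ⟨rfl, h⟩ := insertCopies_inj two_pos (hnot _ hx.1) (hnot _ hx'.1) hx.2 hx'.2 h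
    obtain rfl := Nat.succ_injective h
    rfl
  · intro w hw
    obtain ⟨hp, hs, hh⟩ := mem_cyclicWords.1 hw
    have hmem : n + 1 ∈ baseList (n + 1) := mem_baseList.2 ⟨by omega, le_rfl⟩
    obtain ⟨a, b, rfl⟩ := hs.exists_eq_append
      (fun v hv => (mem_baseList.1 (hp.subset hv)).2) (by rw [hp.count_eq, count_baseList hmem])
    rcases a with _ | ⟨z, a⟩
    · simp only [List.nil_append, List.headI_cons] at hh
      omega
    · refine ⟨⟨z :: a ++ b, a.length⟩, ?_, by simp [insertCopies]⟩
      rw [Finset.mem_sigma, mem_cyclicWords]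
      refine ⟨⟨?_, ?_, by simpa using hh⟩, by simp⟩
      · rw [baseList_succ] at hp
        rw [← List.perm_append_right_iff (List.replicate 2 (n + 1))]
        refine List.Perm.trans ?_ hp
        rw [List.append_assoc]
        exact List.Perm.append_left _ List.perm_append_comm
      · rw [isStirlingWord_iff_sublist] at hs ⊢
        intro x y hxy
        refine hs x y (hxy.trans ?_)
        exact (List.Sublist.refl _).append
          ((List.sublist_cons_self _ _).trans (List.sublist_cons_self _ _))
  · intro _ _
    rfl

theorem sum_cyclicWords_succ_eq_eulerOp {n : ℕ} (hn : 1 ≤ n) :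
    ∑ w ∈ cyclicWords (n + 1), (Polynomial.X : Polynomial ℚ) ^ listCap w =
      2 * eulerOp n (∑ w ∈ cyclicWords n, Polynomial.X ^ listCap w) := by
  rw [eulerOp_sum_X_pow, sum_cyclicWords_succ hn, Finset.mul_sum]
  refine Finset.sum_congr rfl fun w hw => ?_
  have hp := (mem_cyclicWords.1 hw).1
  rw [sum_listCap_insertCopies w fun v hv => Nat.lt_succ_iff.2 (mem_baseList.1 (hp.subset hv)).2,
    hp.length_eq, length_baseList]
  push_cast
  ring

theorem cyclicWords_one : cyclicWords 1 = {[1, 1]} := by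
  ext w
  rw [mem_cyclicWords, Finset.mem_singleton]
  constructor
  · rintro ⟨hp, -, -⟩
    exact List.perm_replicate (n := 2) (a := 1) |>.1 hp
  · rintro rfl
    refine ⟨List.Perm.refl _, ?_, rfl⟩
    rw [isStirlingWord_iff_sublist]
    intro a b h
    simpa using h.length_le

/-- For `n ≥ 1`:  `∑_{σ ∈ CQ_{n+1}} x^{cap(σ)} = 2^n · x · A_n(x)`, where `CQ_{n+1}` is the
set of cyclic Stirling permutations of the second kind of order `n+1` (those consisting of
a single cycle). -/
theorem stmt9 (n : ℕ) (hn : 1 ≤ n) :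
    ∑ σ ∈ (stirling2 (n + 1)).filter (fun c => cyc c = 1), Polynomial.X ^ capSt σ =
      (2 : Polynomial ℚ) ^ n * Polynomial.X * eulerianA n := by
  rw [sum_cyclic_eq_sum_cyclicWords (by omega)]
  induction n, hn using Nat.le_induction with
  | base =>
    rw [sum_cyclicWords_succ_eq_eulerOp le_rfl, cyclicWords_one, eulerianA_one]
    simp [eulerOp, listCap]
  | succ n hn ih =>
    rw [sum_cyclicWords_succ_eq_eulerOp (by omega), ih, mul_assoc, mul_assoc,
      X_mul_eulerianA_succ]
    have h : (2 : Polynomial ℚ) ^ n = Polynomial.C (2 ^ n) := by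
      rw [map_pow, Polynomial.C_ofNat]
    rw [pow_succ, h]
    simp only [eulerOp, Polynomial.derivative_C_mul]
    ring
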